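/- arXiv:2602.20132 — 8 statements merged into one kernel-verified Lean document; each statement's English description precedes it below -/
import Mathlib

section
/- Let Y be a finite nonempty set, let π_old be a policy on Y, let A : Y → ℝ be non-constant on Y, and let ε > 0. Suppose the policy π* maximizes ∑_{y∈Y} A(y)π(y) over the set of all policies π on Y satisfying KL(π‖π_old) ≤ ε. Then the constraint is active, i.e. KL(π*‖π_old) = ε, and there exists a Lagrange multiplier η > 0 such that π* equals the Gibbs policy associated with π_old, A and η, i.e. π*(y) = π_old(y) e^{A(y)/η} / ∑_{y'∈Y} π_old(y') e^{A(y')/η} for all y ∈ Y. -/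
open Finset

/-- A half-space form of Farkas' lemma: if the open half-space `v ⬝ᵥ l < 0` lies in the closed
half-space `v ⬝ᵥ a ≤ 0`, then `a` is a positive multiple of `l`. -/
lemma exists_pos_smul_eq_of_dotProduct_neg_imp {Y : Type*} [Fintype Y] {a l : Y → ℝ}
    (ha : a ≠ 0) (hl : l ≠ 0) (h : ∀ v : Y → ℝ, v ⬝ᵥ l < 0 → v ⬝ᵥ a ≤ 0) :
    ∃ c : ℝ, 0 < c ∧ a = c • l := by
  have hll : 0 < l ⬝ᵥ l :=
    lt_of_le_of_ne (Finset.sum_nonneg fun i _ => mul_self_nonneg (l i))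
      fun h0 => hl (dotProduct_self_eq_zero.1 h0.symm)
  have hla : 0 ≤ l ⬝ᵥ a := by
    have := h (-l) (by simpa using hll)
    simpa using this
  set c := l ⬝ᵥ a / l ⬝ᵥ l with hc
  have hcl : c * l ⬝ᵥ l = l ⬝ᵥ a := div_mul_cancel₀ _ hll.ne'
  have hvl : (a - c • l) ⬝ᵥ l = 0 := by
    rw [sub_dotProduct, smul_dotProduct, smul_eq_mul, hcl, dotProduct_comm a l, sub_self]
  have hva : (a - c • l) ⬝ᵥ a ≤ 0 := by
    refine le_of_forall_pos_le_add fun δ hδ => ?_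
    have hs : 0 < δ / (l ⬝ᵥ a + 1) := by positivity
    have := h (a - c • l - (δ / (l ⬝ᵥ a + 1)) • l) (by
      rw [sub_dotProduct, hvl, smul_dotProduct, smul_eq_mul]
      linarith [mul_pos hs hll])
    rw [sub_dotProduct, smul_dotProduct, smul_eq_mul] at this
    have hδ' : δ / (l ⬝ᵥ a + 1) * (l ⬝ᵥ a + 1) = δ := div_mul_cancel₀ _ (by positivity)
    linarith
  have hvv : (a - c • l) ⬝ᵥ (a - c • l) = 0 := by
    refine le_antisymm ?_ (Finset.sum_nonneg fun i _ => mul_self_nonneg _)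
    rw [dotProduct_sub, dotProduct_smul, hvl, smul_zero, sub_zero]
    exact hva
  have hac : a = c • l := sub_eq_zero.1 (dotProduct_self_eq_zero.1 hvv)
  refine ⟨c, lt_of_le_of_ne (div_nonneg hla hll.le) fun h0 => ha ?_, hac⟩
  rw [hac, ← h0, zero_smul]

/-- The derivative at `p` of the relative entropy to `q`, in a direction of total mass zero. -/
lemma hasDerivAt_sum_mul_log_div {Y : Type*} [Fintype Y] {p q v : Y → ℝ}
    (hp : ∀ y, 0 < p y) (hq : ∀ y, 0 < q y) (hv : ∑ y, v y = 0) :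
    HasDerivAt (fun t : ℝ => ∑ y, (p y + t * v y) * Real.log ((p y + t * v y) / q y))
      (∑ y, v y * Real.log (p y / q y)) 0 := by
  have hsum : ∑ y, v y * Real.log (p y / q y) = ∑ y, (v y * Real.log (p y / q y) + v y) := by
    rw [Finset.sum_add_distrib, hv, add_zero]
  rw [hsum]
  refine HasDerivAt.fun_sum fun y _ => ?_
  have hlin : HasDerivAt (fun t : ℝ => p y + t * v y) (v y) 0 := by
    simpa using ((hasDerivAt_id (0 : ℝ)).mul_const (v y)).const_add (p y)
  have hne : (p y + 0 * v y) / q y ≠ 0 := by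
    simpa using ⟨(hp y).ne', (hq y).ne'⟩
  have hpy := (hp y).ne'
  have hqy := (hq y).ne'
  refine (hlin.mul ((hlin.div_const (q y)).log hne)).congr_deriv ?_
  simp only [zero_mul, add_zero]
  field_simp

/-- A maximizer over a relative entropy ball has no ascent direction of total mass zero along
which the constraint either is slack or strictly decreases to first order. -/
lemma sum_mul_nonpos_of_trust_region_maximizer {Y : Type*} [Fintype Y] {p q A v : Y → ℝ} {ε : ℝ}
    (hp : ∀ y, 0 < p y) (hp_sum : ∑ y, p y = 1) (hq : ∀ y, 0 < q y)
    (hfeas : ∑ y, p y * Real.log (p y / q y) ≤ ε)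
    (hmax : ∀ π : Y → ℝ, (∀ y, 0 < π y) → (∑ y, π y = 1) →
      (∑ y, π y * Real.log (π y / q y)) ≤ ε → (∑ y, A y * π y) ≤ ∑ y, A y * p y)
    (hv : ∑ y, v y = 0)
    (hdir : ∑ y, p y * Real.log (p y / q y) < ε ∨ ∑ y, v y * Real.log (p y / q y) < 0) :
    ∑ y, v y * A y ≤ 0 := by
  have hderiv := hasDerivAt_sum_mul_log_div hp hq hv
  set f : ℝ → ℝ := fun t => ∑ y, (p y + t * v y) * Real.log ((p y + t * v y) / q y) with hf
  have hf0 : f 0 = ∑ y, p y * Real.log (p y / q y) := by simp [hf]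
  have hpos : ∀ᶠ t in nhdsWithin (0 : ℝ) (Set.Ioi 0), ∀ y, 0 < p y + t * v y := by
    refine Filter.Eventually.filter_mono nhdsWithin_le_nhds (Filter.eventually_all.2 fun y => ?_)
    have hc : ContinuousAt (fun t : ℝ => p y + t * v y) 0 := by fun_prop
    exact hc.eventually_const_lt (by simpa using hp y)
  have hle : ∀ᶠ t in nhdsWithin (0 : ℝ) (Set.Ioi 0), f t ≤ ε := by
    rcases hdir with hslack | hdec
    · refine Filter.Eventually.filter_mono nhdsWithin_le_nhds ?_
      filter_upwards [hderiv.continuousAt.eventually_lt_const (hf0 ▸ hslack)] with t ht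
      exact ht.le
    · have hslope := (hderiv.tendsto_slope_zero_right).eventually_lt_const hdec
      filter_upwards [hslope, self_mem_nhdsWithin] with t ht ht0
      rw [zero_add, smul_eq_mul] at ht
      have := (pos_iff_neg_of_mul_neg ht).1 (inv_pos.2 ht0)
      linarith
  obtain ⟨t, ⟨ht_pos, ht_le⟩, ht0⟩ := ((hpos.and hle).and self_mem_nhdsWithin).exists
  have hA := hmax (fun y => p y + t * v y) ht_pos
    (by rw [Finset.sum_add_distrib, ← Finset.mul_sum, hv, hp_sum, mul_zero, add_zero]) ht_le
  have hexp : ∑ y, A y * (p y + t * v y) = ∑ y, A y * p y + t * ∑ y, v y * A y := by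
    rw [Finset.mul_sum, ← Finset.sum_add_distrib]
    exact Finset.sum_congr rfl fun y _ => by ring
  rw [hexp] at hA
  exact nonpos_of_mul_nonpos_right (by linarith) ht0

/-- Subtracting the average makes the total mass zero. -/
lemma sum_sub_average {Y : Type*} [Fintype Y] [Nonempty Y] (f : Y → ℝ) :
    ∑ y, (f y - (∑ z, f z) / Fintype.card Y) = 0 := by
  have : (Fintype.card Y : ℝ) ≠ 0 := by simp
  rw [Finset.sum_sub_distrib, Finset.sum_const, Finset.card_univ, nsmul_eq_mul,
    mul_div_cancel₀ _ this, sub_self]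

/-- Centering either factor of a pairing gives the same value. -/
lemma sum_sub_average_mul {Y : Type*} [Fintype Y] [Nonempty Y] (f g : Y → ℝ) :
    ∑ y, (f y - (∑ z, f z) / Fintype.card Y) * g y =
      ∑ y, f y * (g y - (∑ z, g z) / Fintype.card Y) := by
  simp only [sub_mul, mul_sub, Finset.sum_sub_distrib, ← Finset.mul_sum, ← Finset.sum_mul]
  ring

/-- **Trust-region maximizers are Gibbs policies.** If `A` is non-constant and the
policy `πstar` maximizes expected advantage over the KL-ball of radius `ε > 0`
around `πold`, then the constraint is active (`KL(πstar‖πold) = ε`) and there is a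
Lagrange multiplier `η > 0` with `πstar` equal to the Gibbs policy for `πold, A, η`. -/
theorem trust_region_maximizer_is_gibbs
    {Y : Type*} [Fintype Y] [Nonempty Y]
    (πold : Y → ℝ) (hold_pos : ∀ y, 0 < πold y) (hold_sum : ∑ y, πold y = 1)
    (A : Y → ℝ) (hA_nonconst : ∃ y y' : Y, A y ≠ A y')
    (ε : ℝ) (hε : 0 < ε)
    (πstar : Y → ℝ) (hstar_pos : ∀ y, 0 < πstar y) (hstar_sum : ∑ y, πstar y = 1)
    (hstar_feas : ∑ y, πstar y * Real.log (πstar y / πold y) ≤ ε)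
    (hstar_max : ∀ π : Y → ℝ, (∀ y, 0 < π y) → (∑ y, π y = 1) →
      (∑ y, π y * Real.log (π y / πold y)) ≤ ε →
      (∑ y, A y * π y) ≤ ∑ y, A y * πstar y) :
    (∑ y, πstar y * Real.log (πstar y / πold y)) = ε ∧
    ∃ η : ℝ, 0 < η ∧ ∀ y, πstar y = πold y * Real.exp (A y / η) /
      ∑ y', πold y' * Real.exp (A y' / η) := by
  set L : Y → ℝ := fun y => Real.log (πstar y / πold y) with hL
  set a : Y → ℝ := fun y => A y - (∑ z, A z) / Fintype.card Y with ha
  set l : Y → ℝ := fun y => L y - (∑ z, L z) / Fintype.card Y with hl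
  have hexpL : ∀ y, πold y * Real.exp (L y) = πstar y := fun y => by
    rw [hL, Real.exp_log (div_pos (hstar_pos y) (hold_pos y)),
      mul_div_cancel₀ _ (hold_pos y).ne']
  have ha0 : a ≠ 0 := fun h0 => by
    obtain ⟨y, y', hne⟩ := hA_nonconst
    have hy : a y = 0 := congrFun h0 y
    have hy' : a y' = 0 := congrFun h0 y'
    simp only [ha] at hy hy'
    exact hne (by linarith)
  have hactive : ∑ y, πstar y * Real.log (πstar y / πold y) = ε := by
    by_contra hne
    have haA : ∑ y, a y * A y ≤ 0 :=
      sum_mul_nonpos_of_trust_region_maximizer hstar_pos hstar_sum hold_pos hstar_feas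
        hstar_max (sum_sub_average A) (Or.inl (lt_of_le_of_ne hstar_feas hne))
    have haa : a ⬝ᵥ a ≤ 0 := by
      have hcenter : _ = a ⬝ᵥ a := sum_sub_average_mul a A
      rw [show ∑ y, a y = 0 from sum_sub_average A] at hcenter
      simp only [zero_div, sub_zero] at hcenter
      exact hcenter ▸ haA
    exact ha0 (dotProduct_self_eq_zero.1
      (le_antisymm haa (Finset.sum_nonneg fun i _ => mul_self_nonneg (a i))))
  have hl0 : l ≠ 0 := fun h0 => by
    obtain ⟨K, hK⟩ : ∃ K, ∀ y, L y = K := ⟨_, fun y => sub_eq_zero.1 (congrFun h0 y)⟩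
    have hK1 : Real.exp K = 1 := by
      rw [← hstar_sum, ← one_mul (Real.exp K), ← hold_sum, Finset.sum_mul]
      exact Finset.sum_congr rfl fun y _ => by rw [← hK y, hexpL]
    have hL0 : ∀ y, Real.log (πstar y / πold y) = 0 := fun y =>
      (hK y).trans (Real.exp_eq_one_iff K |>.1 hK1)
    simp only [hL0, mul_zero, Finset.sum_const_zero] at hactive
    exact hε.ne hactive
  refine ⟨hactive, ?_⟩
  obtain ⟨η, hη, hal⟩ := exists_pos_smul_eq_of_dotProduct_neg_imp ha0 hl0 fun v hvl => by
    have := sum_mul_nonpos_of_trust_region_maximizer hstar_pos hstar_sum hold_pos hstar_feas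
      hstar_max (sum_sub_average v) (Or.inr ((sum_sub_average_mul v L).trans_lt hvl))
    rwa [sum_sub_average_mul] at this
  refine ⟨η, hη, ?_⟩
  obtain ⟨K, hK⟩ : ∃ K, ∀ y, A y / η = L y + K := by
    refine ⟨(∑ z, A z) / Fintype.card Y / η - (∑ z, L z) / Fintype.card Y, fun y => ?_⟩
    have hy : A y - (∑ z, A z) / Fintype.card Y = η * (L y - (∑ z, L z) / Fintype.card Y) :=
      congrFun hal y
    rw [eq_add_of_sub_eq hy, add_div, mul_div_cancel_left₀ _ hη.ne']
    ring
  have hweight : ∀ y, πold y * Real.exp (A y / η) = πstar y * Real.exp K := fun y => by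
    rw [hK, Real.exp_add, ← mul_assoc, hexpL]
  intro y
  simp only [hweight]
  rw [← Finset.sum_mul, hstar_sum, one_mul, mul_div_cancel_right₀ _ (Real.exp_ne_zero K)]
end

section
/- Let Y be a finite nonempty set, let π_old be a policy on Y, let A : Y → ℝ, and let η > 0. Let π_G be the Gibbs policy and set ε := KL(π_G‖π_old). Then for every policy π on Y with KL(π‖π_old) ≤ ε, one has ∑_{y∈Y} A(y)π(y) ≤ ∑_{y∈Y} A(y)π_G(y); that is, the Gibbs policy solves the trust-region constrained problem of maximizing expected advantage subject to a KL-ball of radius ε around π_old. -/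
open Finset

/-- The Gibbs inequality: the Kullback–Leibler divergence between positive functions of equal
mass is nonnegative. -/
theorem sum_mul_log_div_nonneg {ι : Type*} [Fintype ι] {p q : ι → ℝ}
    (hp : ∀ i, 0 < p i) (hq : ∀ i, 0 < q i) (hpq : ∑ i, p i = ∑ i, q i) :
    0 ≤ ∑ i, p i * Real.log (p i / q i) := by
  calc (0 : ℝ) = ∑ i, (p i - q i) := by rw [Finset.sum_sub_distrib, hpq, sub_self]
    _ ≤ _ := Finset.sum_le_sum fun i _ => by
      have h := mul_le_mul_of_nonneg_left
        (Real.one_sub_inv_le_log_of_pos (div_pos (hp i) (hq i))) (hp i).le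
      have hi : p i * (1 - (p i / q i)⁻¹) = p i - q i := by
        have := (hp i).ne'
        field_simp
      rwa [hi] at h

/-- **The Gibbs policy solves the trust-region problem.** With `ε := KL(πG‖πold)`,
every policy `π` with `KL(π‖πold) ≤ ε` has expected advantage at most that of the
Gibbs policy `πG`. -/
theorem gibbs_solves_trust_region
    {Y : Type*} [Fintype Y] [Nonempty Y]
    (πold : Y → ℝ) (hold_pos : ∀ y, 0 < πold y) (hold_sum : ∑ y, πold y = 1)
    (A : Y → ℝ) (η : ℝ) (hη : 0 < η)
    (πG : Y → ℝ)
    (hπG : ∀ y, πG y = πold y * Real.exp (A y / η) /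
      ∑ y', πold y' * Real.exp (A y' / η))
    (ε : ℝ) (hε : ε = ∑ y, πG y * Real.log (πG y / πold y)) :
    ∀ π : Y → ℝ, (∀ y, 0 < π y) → (∑ y, π y = 1) →
      (∑ y, π y * Real.log (π y / πold y)) ≤ ε →
      (∑ y, A y * π y) ≤ ∑ y, A y * πG y := by
  intro π hπ hπ_sum hKL
  set Z := ∑ y', πold y' * Real.exp (A y' / η) with hZ
  have hw : ∀ y, 0 < πold y * Real.exp (A y / η) := fun y =>
    mul_pos (hold_pos y) (Real.exp_pos _)
  have hZ_pos : 0 < Z := Finset.sum_pos (fun y _ => hw y) Finset.univ_nonempty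
  have hG_pos : ∀ y, 0 < πG y := fun y => by
    rw [hπG]
    exact div_pos (hw y) hZ_pos
  have hG_sum : ∑ y, πG y = 1 := by
    simp_rw [hπG]
    rw [← Finset.sum_div, ← hZ, div_self hZ_pos.ne']
  have hlog : ∀ y, Real.log (πG y) = Real.log (πold y) + A y / η - Real.log Z := fun y => by
    rw [hπG, Real.log_div (hw y).ne' hZ_pos.ne',
      Real.log_mul (hold_pos y).ne' (Real.exp_ne_zero _), Real.log_exp]
  have hKL_G : ∑ y, πG y * Real.log (πG y / πold y) =
      (∑ y, A y * πG y) / η - Real.log Z := by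
    calc _ = ∑ y, (A y * πG y / η - πG y * Real.log Z) := Finset.sum_congr rfl fun y _ => by
          rw [Real.log_div (hG_pos y).ne' (hold_pos y).ne', hlog]
          ring
      _ = _ := by
          rw [Finset.sum_sub_distrib, ← Finset.sum_div, ← Finset.sum_mul, hG_sum, one_mul]
  have hKL_π : ∑ y, π y * Real.log (π y / πG y) =
      ∑ y, π y * Real.log (π y / πold y) - (∑ y, A y * π y) / η + Real.log Z := by
    calc _ = ∑ y, (π y * Real.log (π y / πold y) - A y * π y / η + π y * Real.log Z) :=
          Finset.sum_congr rfl fun y _ => by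
            rw [Real.log_div (hπ y).ne' (hG_pos y).ne', Real.log_div (hπ y).ne' (hold_pos y).ne',
              hlog]
            ring
      _ = _ := by
          rw [Finset.sum_add_distrib, Finset.sum_sub_distrib, ← Finset.sum_div, ← Finset.sum_mul,
            hπ_sum, one_mul]
  have hgibbs := sum_mul_log_div_nonneg hπ hG_pos (hπ_sum.trans hG_sum.symm)
  rw [← div_le_div_iff_of_pos_right hη]
  linarith
end

section
/- Let Y be a finite nonempty set, let g₁, g₂ : Y → (0,∞), and suppose there is a constant Z > 0 with g₂(y) = Z·g₁(y) for all y ∈ Y. Let f : (0,∞) → ℝ be convex and set G := ∑_{y∈Y} g₁(y). Then for every policy p on Y, ∑_{y∈Y} g₂(y) f( p(y)/g₁(y) ) ≥ Z·G·f(1/G). Moreover, if f is strictly convex, equality holds if and only if p(y) = g₁(y)/G for all y ∈ Y; in particular, any minimizing policy is proportional to g₁. -/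
open Finset

/-- **Linking loss formulations to optimal policies.** If `g₂ = Z·g₁` with `Z > 0`
and `f` is convex on `(0,∞)`, then for every policy `p`,
`∑ g₂(y) f(p(y)/g₁(y)) ≥ Z·G·f(1/G)` where `G = ∑ g₁(y)`; if moreover `f` is
strictly convex, equality holds iff `p(y) = g₁(y)/G` for all `y`, i.e. any
minimizing policy is proportional to `g₁`. -/
theorem lad_optimal_policy_proportional
    {Y : Type*} [Fintype Y] [Nonempty Y]
    (g₁ g₂ : Y → ℝ) (hg₁ : ∀ y, 0 < g₁ y) (hg₂ : ∀ y, 0 < g₂ y)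
    (Z : ℝ) (hZ : 0 < Z) (hZg : ∀ y, g₂ y = Z * g₁ y)
    (f : ℝ → ℝ) (hf : ConvexOn ℝ (Set.Ioi (0 : ℝ)) f)
    (G : ℝ) (hG : G = ∑ y, g₁ y)
    (p : Y → ℝ) (hp_pos : ∀ y, 0 < p y) (hp_sum : ∑ y, p y = 1) :
    (∑ y, g₂ y * f (p y / g₁ y)) ≥ Z * G * f (1 / G) ∧
    (StrictConvexOn ℝ (Set.Ioi (0 : ℝ)) f →
      ((∑ y, g₂ y * f (p y / g₁ y)) = Z * G * f (1 / G) ↔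
        ∀ y, p y = g₁ y / G)) := by
  have hG_pos : 0 < G := hG ▸ sum_pos (fun y _ => hg₁ y) univ_nonempty
  have hw_pos : ∀ y ∈ univ, 0 < g₁ y / G := fun y _ => div_pos (hg₁ y) hG_pos
  have hw_sum : ∑ y, g₁ y / G = 1 := by
    rw [← sum_div, ← hG, div_self hG_pos.ne']
  have hmem : ∀ y ∈ univ, p y / g₁ y ∈ Set.Ioi (0 : ℝ) :=
    fun y _ => div_pos (hp_pos y) (hg₁ y)
  have hmean : ∑ y, (g₁ y / G) • (p y / g₁ y) = 1 / G := by
    rw [← hp_sum, sum_div]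
    refine sum_congr rfl fun y _ => ?_
    have := (hg₁ y).ne'
    rw [smul_eq_mul]
    field_simp
  have hloss : ∑ y, g₂ y * f (p y / g₁ y) =
      Z * G * ∑ y, (g₁ y / G) • f (p y / g₁ y) := by
    rw [mul_sum]
    refine sum_congr rfl fun y _ => ?_
    rw [hZg, smul_eq_mul]
    field_simp
  have hZG : 0 < Z * G := mul_pos hZ hG_pos
  rw [hloss]
  refine ⟨?_, fun hf' => ?_⟩
  · have hjensen := hf.map_sum_le (fun y hy => (hw_pos y hy).le) hw_sum hmem
    rw [hmean] at hjensen
    exact mul_le_mul_of_nonneg_left hjensen hZG.le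
  · have heq := hf'.map_sum_eq_iff hw_pos hw_sum hmem
    rw [hmean] at heq
    rw [mul_right_inj' hZG.ne', eq_comm, heq]
    refine ⟨fun h y => ?_, fun h y _ => ?_⟩
    · rw [(div_eq_iff (hg₁ y).ne').mp (h y (mem_univ y)), one_div_mul_eq_div]
    · rw [h y, div_eq_iff (hg₁ y).ne', one_div_mul_eq_div]
end

section
/- Let Y be a finite nonempty set, let π_old be a policy on Y, let A : Y → ℝ, let η > 0, and let f : (0,∞) → ℝ be strictly convex. Set G := ∑_{y∈Y} π_old(y) e^{A(y)/η}. Then for every policy π on Y, the practical LAD loss satisfies L_pr(π) ≥ G·f(1/G), with equality if and only if π equals the Gibbs policy π_G; in particular, the Gibbs policy is the unique global minimizer of the practical LAD loss over all policies. -/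
open Finset

/-- Jensen's inequality for the perspective sum `∑ y, w y * f (p y / w y)` with positive weights `w`
and a probability vector `p`, together with its equality case `p = w / ∑ w`. -/
lemma StrictConvexOn.le_sum_perspective_and_eq_iff {Y : Type*} [Fintype Y] [Nonempty Y]
    {f : ℝ → ℝ} (hf : StrictConvexOn ℝ (Set.Ioi (0 : ℝ)) f) {w p : Y → ℝ}
    (hw : ∀ y, 0 < w y) (hp : ∀ y, 0 < p y) (hp_sum : ∑ y, p y = 1) :
    (∑ y, w y) * f (1 / ∑ y, w y) ≤ ∑ y, w y * f (p y / w y) ∧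
      (∑ y, w y * f (p y / w y) = (∑ y, w y) * f (1 / ∑ y, w y) ↔
        ∀ y, p y = w y / ∑ y', w y') := by
  have hG : 0 < ∑ y, w y := sum_pos (fun y _ => hw y) univ_nonempty
  set G := ∑ y, w y with hG_def
  have h_pos : ∀ y ∈ univ, 0 < w y / G := fun y _ => div_pos (hw y) hG
  have h_sum : ∑ y, w y / G = 1 := by rw [← sum_div, ← hG_def, div_self hG.ne']
  have h_mem : ∀ y ∈ univ, p y / w y ∈ Set.Ioi (0 : ℝ) := fun y _ => div_pos (hp y) (hw y)
  have h_mean : ∑ y, (w y / G) • (p y / w y) = 1 / G := by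
    rw [← hp_sum, sum_div]
    refine sum_congr rfl fun y _ => ?_
    have := (hw y).ne'
    rw [smul_eq_mul]
    field_simp
  have h_loss : ∑ y, w y * f (p y / w y) = G * ∑ y, (w y / G) • f (p y / w y) := by
    rw [mul_sum]
    refine sum_congr rfl fun y _ => ?_
    rw [smul_eq_mul]
    field_simp
  have h_le := hf.convexOn.map_sum_le (fun y hy => (h_pos y hy).le) h_sum h_mem
  have h_eq := hf.map_sum_eq_iff h_pos h_sum h_mem
  rw [h_mean] at h_le h_eq
  rw [h_loss]
  refine ⟨mul_le_mul_of_nonneg_left h_le hG.le, ?_⟩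
  rw [mul_right_inj' hG.ne', eq_comm, h_eq]
  refine ⟨fun h y => ?_, fun h y _ => ?_⟩
  · rw [(div_eq_iff (hw y).ne').1 (h y (mem_univ y)), one_div_mul_eq_div]
  · rw [div_eq_iff (hw y).ne', one_div_mul_eq_div, h y]

/-- **The Gibbs policy uniquely minimizes the practical LAD loss.** With
`G := ∑ πold(y)·exp(A(y)/η)` and `f` strictly convex on `(0,∞)`, every policy `π`
satisfies `L_pr(π) ≥ G·f(1/G)`, with equality iff `π` is the Gibbs policy. -/
theorem gibbs_uniquely_minimizes_practical_LAD
    {Y : Type*} [Fintype Y] [Nonempty Y]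
    (πold : Y → ℝ) (hold_pos : ∀ y, 0 < πold y) (hold_sum : ∑ y, πold y = 1)
    (A : Y → ℝ) (η : ℝ) (hη : 0 < η)
    (f : ℝ → ℝ) (hf : StrictConvexOn ℝ (Set.Ioi (0 : ℝ)) f)
    (G : ℝ) (hG : G = ∑ y, πold y * Real.exp (A y / η))
    (π : Y → ℝ) (hπ_pos : ∀ y, 0 < π y) (hπ_sum : ∑ y, π y = 1) :
    (∑ y, πold y * Real.exp (A y / η) *
        f (π y / (πold y * Real.exp (A y / η)))) ≥ G * f (1 / G) ∧
    ((∑ y, πold y * Real.exp (A y / η) *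
        f (π y / (πold y * Real.exp (A y / η)))) = G * f (1 / G) ↔
      ∀ y, π y = πold y * Real.exp (A y / η) /
        ∑ y', πold y' * Real.exp (A y' / η)) := by
  subst hG
  exact hf.le_sum_perspective_and_eq_iff
    (fun y => mul_pos (hold_pos y) (Real.exp_pos _)) hπ_pos hπ_sum
end

section
/- Let Y be a finite nonempty set, let π_old be a policy on Y, let A : Y → ℝ, let η > 0, and let f : (0,∞) → ℝ be convex with f(1) = 0. Then for every policy π on Y, the theoretical LAD loss satisfies L_th(π) ≥ 0, and L_th(π_G) = 0 for the Gibbs policy π_G. Moreover, if f is strictly convex, then L_th(π) = 0 if and only if π = π_G; in particular, the Gibbs policy is the unique global minimizer of the theoretical LAD loss. -/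
open Finset

section FDivergence

variable {Y : Type*} [Fintype Y] {f : ℝ → ℝ} {p q : Y → ℝ}

/-- Nonnegativity of a finite `f`-divergence. -/
theorem sum_mul_map_div_nonneg (hf : ConvexOn ℝ (Set.Ioi (0 : ℝ)) f) (hf1 : f 1 = 0)
    (hp : ∀ y, 0 < p y) (hq : ∀ y, 0 < q y) (hp1 : ∑ y, p y = 1) (hq1 : ∑ y, q y = 1) :
    0 ≤ ∑ y, q y * f (p y / q y) := by
  have jensen := hf.map_sum_le (t := univ) (w := q) (p := fun y => p y / q y)
    (fun y _ => (hq y).le) hq1 (fun y _ => div_pos (hp y) (hq y))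
  simpa [mul_div_cancel₀ _ (hq _).ne', hp1, hf1] using jensen

/-- A finite `f`-divergence with `f` strictly convex vanishes only on the diagonal. -/
theorem eq_of_sum_mul_map_div_eq_zero (hf : StrictConvexOn ℝ (Set.Ioi (0 : ℝ)) f)
    (hf1 : f 1 = 0) (hp : ∀ y, 0 < p y) (hq : ∀ y, 0 < q y) (hp1 : ∑ y, p y = 1)
    (hq1 : ∑ y, q y = 1) (h : ∑ y, q y * f (p y / q y) = 0) : p = q := by
  have hpq : ∀ y, q y * (p y / q y) = p y := fun y => mul_div_cancel₀ _ (hq y).ne'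
  have hconst := hf.eq_of_le_map_sum (t := univ) (w := q) (p := fun y => p y / q y)
    (fun y _ => hq y) hq1 (fun y _ => div_pos (hp y) (hq y))
    (by simp only [smul_eq_mul, hpq, hp1, hf1, h, le_refl])
  funext y
  have hy : p y / q y = 1 := by
    calc p y / q y = ∑ z, q z * (p y / q y) := by rw [← sum_mul, hq1, one_mul]
      _ = ∑ z, q z * (p z / q z) :=
        sum_congr rfl fun z _ => by rw [hconst (mem_univ y) (mem_univ z)]
      _ = 1 := by simp only [hpq, hp1]
  exact (div_eq_one_iff_eq (hq y).ne').mp hy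

end FDivergence

section Normalization

variable {Y : Type*} [Fintype Y] [Nonempty Y] {w : Y → ℝ}

theorem sum_univ_pos_of_pos (hw : ∀ y, 0 < w y) : 0 < ∑ y, w y :=
  sum_pos (fun y _ => hw y) univ_nonempty

theorem div_sum_pos (hw : ∀ y, 0 < w y) (y : Y) : 0 < w y / ∑ z, w z :=
  div_pos (hw y) (sum_univ_pos_of_pos hw)

theorem sum_div_sum_eq_one (hw : ∀ y, 0 < w y) : ∑ y, w y / ∑ z, w z = 1 := by
  rw [← sum_div, div_self (sum_univ_pos_of_pos hw).ne']

end Normalization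

/-- **The Gibbs policy uniquely minimizes the theoretical LAD loss.** With
`P_π(y) = (π(y)/πold(y))/Z_π`, `P_A(y) = exp(A(y)/η)/Z_A`, and `f` convex on
`(0,∞)` with `f(1) = 0`, the theoretical LAD loss
`L_th(π) = ∑ P_A(y) f(P_π(y)/P_A(y))` is nonnegative, vanishes at the Gibbs
policy, and, when `f` is strictly convex, vanishes only at the Gibbs policy. -/
theorem gibbs_uniquely_minimizes_theoretical_LAD
    {Y : Type*} [Fintype Y] [Nonempty Y]
    (πold : Y → ℝ) (hold_pos : ∀ y, 0 < πold y) (hold_sum : ∑ y, πold y = 1)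
    (A : Y → ℝ) (η : ℝ) (hη : 0 < η)
    (f : ℝ → ℝ) (hf : ConvexOn ℝ (Set.Ioi (0 : ℝ)) f) (hf1 : f 1 = 0)
    (πG : Y → ℝ)
    (hπG : ∀ y, πG y = πold y * Real.exp (A y / η) /
      ∑ y', πold y' * Real.exp (A y' / η))
    (Lth : (Y → ℝ) → ℝ)
    (hLth : ∀ π : Y → ℝ, Lth π =
      ∑ y, (Real.exp (A y / η) / ∑ y', Real.exp (A y' / η)) *
        f (((π y / πold y) / ∑ y', π y' / πold y') /
           (Real.exp (A y / η) / ∑ y', Real.exp (A y' / η)))) :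
    (∀ π : Y → ℝ, (∀ y, 0 < π y) → (∑ y, π y = 1) → 0 ≤ Lth π) ∧
    Lth πG = 0 ∧
    (StrictConvexOn ℝ (Set.Ioi (0 : ℝ)) f →
      ∀ π : Y → ℝ, (∀ y, 0 < π y) → (∑ y, π y = 1) →
        (Lth π = 0 ↔ π = πG)) := by
  have he : ∀ y, 0 < Real.exp (A y / η) := fun y => Real.exp_pos _
  have hS : 0 < ∑ y, πold y * Real.exp (A y / η) :=
    sum_univ_pos_of_pos fun y => mul_pos (hold_pos y) (he y)
  have hratio : ∀ π : Y → ℝ, (∀ y, 0 < π y) → ∀ y, 0 < π y / πold y :=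
    fun π hπ y => div_pos (hπ y) (hold_pos y)
  have hG : Lth πG = 0 := by
    have hGratio : ∀ y, πG y / πold y =
        Real.exp (A y / η) / ∑ y', πold y' * Real.exp (A y' / η) := fun y => by
      rw [hπG, div_right_comm, mul_div_cancel_left₀ _ (hold_pos y).ne']
    rw [hLth]
    refine sum_eq_zero fun y _ => ?_
    simp only [hGratio]
    rw [← sum_div, div_div_div_cancel_right₀ hS.ne', div_self (div_sum_pos he y).ne', hf1,
      mul_zero]
  refine ⟨fun π hπ _ => ?_, hG, fun hfs π hπ hπ1 => ⟨fun h => ?_, fun h => h ▸ hG⟩⟩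
  · rw [hLth]
    exact sum_mul_map_div_nonneg hf hf1 (div_sum_pos (hratio π hπ)) (div_sum_pos he)
      (sum_div_sum_eq_one (hratio π hπ)) (sum_div_sum_eq_one he)
  · rw [hLth] at h
    have hP := eq_of_sum_mul_map_div_eq_zero hfs hf1 (div_sum_pos (hratio π hπ))
      (div_sum_pos he) (sum_div_sum_eq_one (hratio π hπ)) (sum_div_sum_eq_one he) h
    have hZ := sum_univ_pos_of_pos (hratio π hπ)
    obtain ⟨c, hc⟩ : ∃ c, ∀ y, π y = c * (πold y * Real.exp (A y / η)) := by
      refine ⟨(∑ y, π y / πold y) / ∑ y, Real.exp (A y / η), fun y => ?_⟩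
      have hy := congrFun hP y
      rw [div_eq_iff hZ.ne', div_eq_iff (hold_pos y).ne'] at hy
      rw [hy]
      ring
    have hcS : c * ∑ y, πold y * Real.exp (A y / η) = 1 := by
      rw [mul_sum, ← hπ1]
      exact sum_congr rfl fun y _ => (hc y).symm
    funext y
    rw [hπG, hc, eq_div_iff hS.ne', mul_right_comm, hcS, one_mul]
end

section
/- Let Y be a finite set with |Y| = N ≥ 1, let η > 0, let f : (0,∞) → ℝ be convex and differentiable, and fix γ̄ > 0 and δ̄ ∈ (0,1). Then there exists a constant K > 0, depending only on f, η, N, γ̄ and δ̄, such that for all policies π, π_old on Y, all advantage functions A : Y → ℝ, and all γ ∈ (0, γ̄], δ ∈ (0, δ̄] satisfying |A(y)| ≤ γ and |π(y)/π_old(y) − 1| ≤ δ for every y ∈ Y, the theoretical and practical LAD losses satisfy |L_th(π) − L_pr(π)| ≤ K·(γ + δ). In other words, the practical LAD loss is an O(γ + δ)-accurate surrogate of the theoretical LAD objective. -/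
open Finset

/-- A function differentiable on the positive reals satisfies a Lipschitz-type bound at `1`,
uniformly on compact subintervals of the positive reals. -/
lemma exists_abs_sub_apply_one_le {f : ℝ → ℝ} (hf : DifferentiableOn ℝ f (Set.Ioi 0))
    {a b : ℝ} (ha : 0 < a) :
    ∃ L, 0 ≤ L ∧ ∀ x ∈ Set.Icc a b, |f x - f 1| ≤ L * |x - 1| := by
  have hone : Set.Ioi (0 : ℝ) ∈ nhds 1 := Ioi_mem_nhds one_pos
  have hcont : ContinuousOn (dslope f 1) (Set.Ioi 0) :=
    (continuousOn_dslope hone).2 ⟨hf.continuousOn, hf.differentiableAt hone⟩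
  obtain ⟨L, hL⟩ := isCompact_Icc.exists_bound_of_continuousOn
    (hcont.mono fun x (hx : x ∈ Set.Icc a b) => lt_of_lt_of_le ha hx.1)
  refine ⟨|L|, abs_nonneg L, fun x hx => ?_⟩
  have hslope : f x - f 1 = (x - 1) * dslope f 1 x := by
    simpa using (sub_smul_dslope f 1 x).symm
  rw [hslope, abs_mul, mul_comm]
  exact mul_le_mul_of_nonneg_right ((hL x hx).trans (le_abs_self L)) (abs_nonneg _)

lemma abs_exp_sub_one_le_abs_mul_exp_abs (x : ℝ) :
    |Real.exp x - 1| ≤ |x| * Real.exp |x| := by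
  rcases le_total 0 x with hx | hx
  · rw [abs_of_nonneg hx, abs_of_nonneg (by linarith [Real.add_one_le_exp x])]
    have hinv : Real.exp (-x) * Real.exp x = 1 := by rw [← Real.exp_add]; simp
    nlinarith [Real.add_one_le_exp (-x), Real.exp_pos x]
  · rw [abs_of_nonpos hx, abs_of_nonpos (by linarith [Real.exp_le_one_iff.2 hx])]
    nlinarith [Real.add_one_le_exp x, Real.one_le_exp (neg_nonneg.2 hx)]

/-- Normalizing weights that are within `d` of `1` and at least `m` yields a distribution within
`2 * d / m` of the uniform one in `ℓ¹`. -/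
lemma sum_abs_div_sum_sub_inv_card_le {Y : Type*} [Fintype Y] [Nonempty Y] {r : Y → ℝ} {d m : ℝ}
    (hm : 0 < m) (hr : ∀ y, m ≤ r y) (hd : ∀ y, |r y - 1| ≤ d) :
    ∑ y, |r y / ∑ y', r y' - 1 / Fintype.card Y| ≤ 2 * d / m := by
  set Z := ∑ y', r y' with hZ
  set n := (Fintype.card Y : ℝ) with hn
  have hn0 : 0 < n := by rw [hn]; exact_mod_cast Fintype.card_pos
  have hd0 : 0 ≤ d := (abs_nonneg _).trans (hd (Classical.arbitrary Y))
  have hZm : n * m ≤ Z := by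
    simpa [hn] using Finset.card_nsmul_le_sum univ r m fun y _ => hr y
  have hZ0 : 0 < Z := (mul_pos hn0 hm).trans_le hZm
  have hZn : |Z - n| ≤ n * d := by
    calc |Z - n| = |∑ y, (r y - 1)| := by simp [hZ, hn, Finset.sum_sub_distrib]
      _ ≤ ∑ y, |r y - 1| := Finset.abs_sum_le_sum_abs _ _
      _ ≤ ∑ _y : Y, d := Finset.sum_le_sum fun y _ => hd y
      _ = n * d := by simp [hn]
  have hterm (y : Y) : |r y / Z - 1 / n| ≤ 2 * d / m / n := by
    have heq : r y / Z - 1 / n = ((r y - 1) * n - (Z - n)) / (Z * n) := by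
      field_simp; ring
    have hnum : |(r y - 1) * n - (Z - n)| ≤ 2 * d * n := by
      have h := abs_sub ((r y - 1) * n) (Z - n)
      rw [abs_mul, abs_of_pos hn0] at h
      nlinarith [hd y]
    rw [heq, abs_div, abs_of_pos (mul_pos hZ0 hn0), div_div, div_le_div_iff₀ (by positivity)
      (by positivity)]
    calc |(r y - 1) * n - (Z - n)| * (m * n) ≤ 2 * d * n * (m * n) := by gcongr
      _ = 2 * d * (n * m * n) := by ring
      _ ≤ 2 * d * (Z * n) := by gcongr
  calc ∑ y, |r y / Z - 1 / n| ≤ ∑ _y : Y, 2 * d / m / n := Finset.sum_le_sum fun y _ => hterm y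
    _ = 2 * d / m := by
      rw [Finset.sum_const, Finset.card_univ, nsmul_eq_mul, ← hn]; field_simp

/-- A bound for an `f`-divergence-type sum in terms of the `ℓ¹` distance. -/
lemma abs_sum_mul_apply_div_sub_le {Y : Type*} [Fintype Y] {f : ℝ → ℝ} {L : ℝ} {p q : Y → ℝ}
    (hq : ∀ y, 0 < q y) (hL : ∀ y, |f (p y / q y) - f 1| ≤ L * |p y / q y - 1|) :
    |∑ y, q y * f (p y / q y) - (∑ y, q y) * f 1| ≤ L * ∑ y, |p y - q y| := by
  rw [Finset.sum_mul, ← Finset.sum_sub_distrib, Finset.mul_sum]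
  refine (Finset.abs_sum_le_sum_abs _ _).trans (Finset.sum_le_sum fun y _ => ?_)
  have hpq : p y - q y = q y * (p y / q y - 1) := by
    have := (hq y).ne'
    field_simp
  rw [← mul_sub, abs_mul, hpq, abs_mul, abs_of_pos (hq y)]
  nlinarith [hL y, hq y]

/-- Normalizing positive weights with pairwise ratios in `[c, d]` gives ratios in
`[c / d, d / c]`. -/
lemma div_sum_div_div_sum_mem_Icc {Y : Type*} [Fintype Y] {r s : Y → ℝ} {c d : ℝ}
    (hc : 0 < c) (hd : 0 < d) (hr : ∀ y, 0 < r y) (hs : ∀ y, 0 < s y)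
    (hcr : ∀ y, c * s y ≤ r y) (hrd : ∀ y, r y ≤ d * s y) (y : Y) :
    (r y / ∑ y', r y') / (s y / ∑ y', s y') ∈ Set.Icc (c / d) (d / c) := by
  have hR : 0 < ∑ y', r y' := Finset.sum_pos (fun y _ => hr y) ⟨y, mem_univ y⟩
  have hS : 0 < ∑ y', s y' := Finset.sum_pos (fun y _ => hs y) ⟨y, mem_univ y⟩
  have hcR : c * ∑ y', s y' ≤ ∑ y', r y' := by
    rw [Finset.mul_sum]; exact Finset.sum_le_sum fun y _ => hcr y
  have hRd : ∑ y', r y' ≤ d * ∑ y', s y' := by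
    rw [Finset.mul_sum]; exact Finset.sum_le_sum fun y _ => hrd y
  have hry := hr y
  have hsy := hs y
  rw [div_div_div_eq]
  constructor
  · rw [div_le_div_iff₀ hd (by positivity)]
    calc c * ((∑ y', r y') * s y) = (c * s y) * ∑ y', r y' := by ring
      _ ≤ r y * (d * ∑ y', s y') := mul_le_mul (hcr y) hRd hR.le hry.le
      _ = r y * (∑ y', s y') * d := by ring
  · rw [div_le_div_iff₀ (by positivity) hc]
    calc r y * (∑ y', s y') * c = r y * (c * ∑ y', s y') := by ring
      _ ≤ (d * s y) * ∑ y', r y' := mul_le_mul (hrd y) hcR (by positivity) (by positivity)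
      _ = d * ((∑ y', r y') * s y) := by ring

/-- **The practical LAD loss is an `O(γ+δ)`-accurate surrogate of the theoretical
LAD objective.** For a fixed finite action space of size `N`, a fixed `η > 0`, a
fixed convex differentiable `f` on `(0,∞)`, and fixed bounds `γ̄ > 0`,
`δ̄ ∈ (0,1)`, there is a constant `K > 0` such that whenever `|A| ≤ γ ≤ γ̄` and
`|π/πold − 1| ≤ δ ≤ δ̄` pointwise, we have `|L_th(π) − L_pr(π)| ≤ K·(γ + δ)`. -/
theorem practical_LAD_is_accurate_surrogate
    {Y : Type*} [Fintype Y] (N : ℕ) (hN : Fintype.card Y = N) (hN1 : 1 ≤ N)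
    (η : ℝ) (hη : 0 < η)
    (f : ℝ → ℝ) (hconv : ConvexOn ℝ (Set.Ioi (0 : ℝ)) f)
    (hdiff : DifferentiableOn ℝ f (Set.Ioi (0 : ℝ)))
    (γbar δbar : ℝ) (hγbar : 0 < γbar) (hδbar0 : 0 < δbar) (hδbar1 : δbar < 1) :
    ∃ K : ℝ, 0 < K ∧
      ∀ (π πold : Y → ℝ) (A : Y → ℝ) (γ δ : ℝ),
        (∀ y, 0 < π y) → (∑ y, π y = 1) →
        (∀ y, 0 < πold y) → (∑ y, πold y = 1) →
        0 < γ → γ ≤ γbar → 0 < δ → δ ≤ δbar →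
        (∀ y, |A y| ≤ γ) → (∀ y, |π y / πold y - 1| ≤ δ) →
        |(∑ y, (Real.exp (A y / η) / ∑ y', Real.exp (A y' / η)) *
            f (((π y / πold y) / ∑ y', π y' / πold y') /
               (Real.exp (A y / η) / ∑ y', Real.exp (A y' / η)))) -
         (∑ y, πold y * Real.exp (A y / η) *
            f (π y / (πold y * Real.exp (A y / η))))| ≤ K * (γ + δ) := by
  have : Nonempty Y := Fintype.card_pos_iff.1 (by omega)
  obtain ⟨E, hE⟩ : ∃ E, E = Real.exp (γbar / η) := ⟨_, rfl⟩
  have hE1 : 1 ≤ E := by rw [hE]; exact Real.one_le_exp (by positivity)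
  have hE0 : 0 < E := one_pos.trans_le hE1
  obtain ⟨m, hm⟩ : ∃ m, m = 1 - δbar := ⟨_, rfl⟩
  have hm0 : 0 < m := by linarith
  obtain ⟨c, hc⟩ : ∃ c, c = m / E := ⟨_, rfl⟩
  obtain ⟨d, hd⟩ : ∃ d, d = 2 * E := ⟨_, rfl⟩
  obtain ⟨C, hC⟩ : ∃ C, C = E / η := ⟨_, rfl⟩
  have hc0 : 0 < c := by rw [hc]; positivity
  have hc1 : c ≤ 1 := by rw [hc, div_le_one hE0]; linarith
  have hd1 : 1 ≤ d := by linarith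
  have hd0 : 0 < d := by linarith
  have hC0 : 0 < C := by rw [hC]; positivity
  obtain ⟨L, hL0, hL⟩ :=
    exists_abs_sub_apply_one_le (a := c / d) (b := d / c) hdiff (by positivity)
  refine ⟨(L * (2 / m) + L) + (L * (2 * C * E) + L * C + |f 1| * C) + 1, by positivity, ?_⟩
  intro π πold A γ δ hπ hπsum hold holdsum hγ hγb hδ hδb hA hr
  have hs0 (y : Y) : 0 < Real.exp (A y / η) := Real.exp_pos _
  have hr0 (y : Y) : 0 < π y / πold y := div_pos (hπ y) (hold y)
  have habs (y : Y) : |A y / η| ≤ γ / η := by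
    rw [abs_div, abs_of_pos hη]; gcongr; exact hA y
  have habs' (y : Y) : |A y / η| ≤ γbar / η := (habs y).trans (by gcongr)
  have hsE (y : Y) : Real.exp (A y / η) ≤ E := by
    rw [hE]; exact Real.exp_le_exp.2 ((le_abs_self _).trans (habs' y))
  have hEs (y : Y) : 1 / E ≤ Real.exp (A y / η) := by
    rw [hE, one_div, ← Real.exp_neg]
    exact Real.exp_le_exp.2 (abs_le.1 (habs' y)).1
  have hs1 (y : Y) : |Real.exp (A y / η) - 1| ≤ C * γ :=
    calc |Real.exp (A y / η) - 1| ≤ |A y / η| * Real.exp |A y / η| :=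
          abs_exp_sub_one_le_abs_mul_exp_abs _
      _ ≤ γ / η * E := by
          rw [hE]
          exact mul_le_mul (habs y) (Real.exp_le_exp.2 (habs' y)) (Real.exp_pos _).le
            (by positivity)
      _ = C * γ := by rw [hC]; ring
  have hmr (y : Y) : m ≤ π y / πold y := by linarith [(abs_le.1 (hr y)).1]
  have hr2 (y : Y) : π y / πold y ≤ 2 := by linarith [(abs_le.1 (hr y)).2]
  have hcr (y : Y) : c * Real.exp (A y / η) ≤ π y / πold y :=
    calc c * Real.exp (A y / η) ≤ c * E := by gcongr; exact hsE y
      _ = m := by rw [hc]; field_simp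
      _ ≤ _ := hmr y
  have hrd (y : Y) : π y / πold y ≤ d * Real.exp (A y / η) :=
    calc π y / πold y ≤ 2 := hr2 y
      _ = d * (1 / E) := by rw [hd]; field_simp
      _ ≤ _ := by gcongr; exact hEs y
  have hSpos : 0 < ∑ y, Real.exp (A y / η) := Finset.sum_pos (fun y _ => hs0 y) univ_nonempty
  -- theoretical loss versus `f 1`
  have hth := abs_sum_mul_apply_div_sub_le (f := f) (L := L)
    (p := fun y => (π y / πold y) / ∑ y', π y' / πold y')
    (q := fun y => Real.exp (A y / η) / ∑ y', Real.exp (A y' / η))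
    (fun y => div_pos (hs0 y) hSpos)
    (fun y => hL _ (div_sum_div_div_sum_mem_Icc hc0 hd0 hr0 hs0 hcr hrd y))
  rw [← Finset.sum_div, div_self hSpos.ne', one_mul] at hth
  have hdist : ∑ y, |(π y / πold y) / ∑ y', π y' / πold y' -
      Real.exp (A y / η) / ∑ y', Real.exp (A y' / η)| ≤ 2 / m * δ + 2 * C * E * γ := by
    have h₁ := sum_abs_div_sum_sub_inv_card_le hm0 hmr hr
    have h₂ := sum_abs_div_sum_sub_inv_card_le (one_div_pos.2 hE0) hEs hs1
    calc _ ≤ ∑ y, (|(π y / πold y) / ∑ y', π y' / πold y' - 1 / Fintype.card Y| +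
          |Real.exp (A y / η) / ∑ y', Real.exp (A y' / η) - 1 / Fintype.card Y|) := by
          refine Finset.sum_le_sum fun y _ => ?_
          rw [abs_sub_comm (Real.exp (A y / η) / _)]
          exact abs_sub_le _ _ _
      _ ≤ 2 * δ / m + 2 * (C * γ) / (1 / E) := by
          rw [Finset.sum_add_distrib]; exact add_le_add h₁ h₂
      _ = _ := by field_simp
  -- practical loss versus `f 1`
  have hpr := abs_sum_mul_apply_div_sub_le (f := f) (L := L) (p := π)
    (q := fun y => πold y * Real.exp (A y / η)) (fun y => mul_pos (hold y) (hs0 y))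
    (fun y => by
      refine hL _ ?_
      rw [← div_div]
      have hlo : c ≤ π y / πold y / Real.exp (A y / η) := (le_div_iff₀ (hs0 y)).2 (hcr y)
      have hhi : π y / πold y / Real.exp (A y / η) ≤ d := (div_le_iff₀ (hs0 y)).2 (hrd y)
      exact ⟨(div_le_self hc0.le hd1).trans hlo,
        hhi.trans (le_div_self hd0.le hc0 hc1)⟩)
  have hw (y : Y) : |πold y * Real.exp (A y / η) - πold y| ≤ πold y * (C * γ) := by
    rw [← mul_sub_one, abs_mul, abs_of_pos (hold y)]
    exact mul_le_mul_of_nonneg_left (hs1 y) (hold y).le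
  have hmass : |∑ y, πold y * Real.exp (A y / η) - 1| ≤ C * γ :=
    calc |∑ y, πold y * Real.exp (A y / η) - 1|
        = |∑ y, (πold y * Real.exp (A y / η) - πold y)| := by
          rw [Finset.sum_sub_distrib, holdsum]
      _ ≤ ∑ y, πold y * (C * γ) :=
          (Finset.abs_sum_le_sum_abs _ _).trans (Finset.sum_le_sum fun y _ => hw y)
      _ = C * γ := by rw [← Finset.sum_mul, holdsum, one_mul]
  have hdist' : ∑ y, |π y - πold y * Real.exp (A y / η)| ≤ δ + C * γ :=
    calc ∑ y, |π y - πold y * Real.exp (A y / η)| ≤ ∑ y, πold y * (δ + C * γ) := by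
          refine Finset.sum_le_sum fun y _ => ?_
          have hπold : |π y - πold y| ≤ πold y * δ := by
            have h : π y - πold y = πold y * (π y / πold y - 1) := by
              have := (hold y).ne'
              field_simp
            rw [h, abs_mul, abs_of_pos (hold y)]
            exact mul_le_mul_of_nonneg_left (hr y) (hold y).le
          have htri := abs_sub_le (π y) (πold y) (πold y * Real.exp (A y / η))
          rw [abs_sub_comm (πold y)] at htri
          linarith [hw y]
      _ = δ + C * γ := by rw [← Finset.sum_mul, holdsum, one_mul]
  have hmassf : |(∑ y, πold y * Real.exp (A y / η)) * f 1 - f 1| ≤ |f 1| * (C * γ) := by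
    rw [← sub_one_mul, abs_mul, mul_comm]
    exact mul_le_mul_of_nonneg_left hmass (abs_nonneg _)
  have hth' := hth.trans (mul_le_mul_of_nonneg_left hdist hL0)
  have hpr' := hpr.trans (mul_le_mul_of_nonneg_left hdist' hL0)
  have hcoefδ : 0 ≤ (L * (2 / m) + L) * γ := by positivity
  have hcoefγ : 0 ≤ (L * (2 * C * E) + L * C + |f 1| * C) * δ := by positivity
  rw [abs_le] at hth' hpr' hmassf ⊢
  constructor <;> linarith [hth'.1, hth'.2, hpr'.1, hpr'.2, hmassf.1, hmassf.2]
end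

section
/- Let Y be a finite nonempty set, let π_old be a policy on Y, let A : Y → ℝ, let η > 0, and let f : (0,∞) → ℝ be differentiable. Let I ⊆ ℝ be open, θ₀ ∈ I, and let π : I × Y → (0,∞) be such that for each y ∈ Y the map θ ↦ π(θ, y) is differentiable at θ₀, with derivative π'(y), and write ℓ'(y) := π'(y)/π(θ₀, y) for the derivative of θ ↦ log π(θ, y) at θ₀. Then the map θ ↦ ∑_{y∈Y} π_old(y) e^{A(y)/η} f( π(θ,y)/(π_old(y) e^{A(y)/η}) ) is differentiable at θ₀ with derivative ∑_{y∈Y} π(θ₀, y) · f'( π(θ₀,y)/(π_old(y) e^{A(y)/η}) ) · ℓ'(y); that is, the gradient of the practical LAD loss is the expectation under π(θ₀, ·) of f'((π/π_old)·e^{−A/η}) times the score function. -/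
open Finset

/-- **Gradient of the practical LAD loss.** If each `θ ↦ π θ y` is positive on an
open set `I ∋ θ₀` and differentiable at `θ₀` with derivative `π' y`, and
`ℓ' y = π' y / π θ₀ y` is the score (the derivative of `θ ↦ log (π θ y)` at `θ₀`),
then the practical LAD loss `θ ↦ ∑ πold(y) e^{A(y)/η} f(π θ y/(πold(y) e^{A(y)/η}))`
is differentiable at `θ₀` with derivative
`∑ π θ₀ y · f'(π θ₀ y/(πold(y) e^{A(y)/η})) · ℓ' y`. -/
theorem practical_LAD_gradient
    {Y : Type*} [Fintype Y] [Nonempty Y]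
    (πold : Y → ℝ) (hold_pos : ∀ y, 0 < πold y) (hold_sum : ∑ y, πold y = 1)
    (A : Y → ℝ) (η : ℝ) (hη : 0 < η)
    (f f' : ℝ → ℝ) (hf : ∀ x : ℝ, 0 < x → HasDerivAt f (f' x) x)
    (I : Set ℝ) (hI : IsOpen I) (θ₀ : ℝ) (hθ₀ : θ₀ ∈ I)
    (π : ℝ → Y → ℝ) (hπ_pos : ∀ θ ∈ I, ∀ y, 0 < π θ y)
    (π' : Y → ℝ) (hπ' : ∀ y, HasDerivAt (fun θ => π θ y) (π' y) θ₀)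
    (ℓ' : Y → ℝ) (hℓ' : ∀ y, ℓ' y = π' y / π θ₀ y) :
    HasDerivAt
      (fun θ => ∑ y, πold y * Real.exp (A y / η) *
        f (π θ y / (πold y * Real.exp (A y / η))))
      (∑ y, π θ₀ y * f' (π θ₀ y / (πold y * Real.exp (A y / η))) * ℓ' y)
      θ₀ := by
  refine HasDerivAt.fun_sum fun y _ => ?_
  have hπ : 0 < π θ₀ y := hπ_pos θ₀ hθ₀ y
  have hw : 0 < πold y * Real.exp (A y / η) := mul_pos (hold_pos y) (Real.exp_pos _)
  generalize πold y * Real.exp (A y / η) = w at hw ⊢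
  have hchain : HasDerivAt (fun θ => w * f (π θ y / w))
      (w * (f' (π θ₀ y / w) * (π' y / w))) θ₀ :=
    ((hf _ (div_pos hπ hw)).comp θ₀ ((hπ' y).div_const w)).const_mul w
  refine hchain.congr_deriv ?_
  rw [hℓ' y]
  field_simp
end

section
/- Let Y be a finite nonempty set, let π_old be a policy on Y, let A : Y → ℝ, let η > 0, and let f : (0,∞) → ℝ be differentiable. Let I ⊆ ℝ be open, θ₀ ∈ I, and let π : I × Y → (0,∞) be such that for each y ∈ Y the map θ ↦ π(θ, y) is differentiable at θ₀, and write ℓ'(y) for the derivative of θ ↦ log π(θ, y) at θ₀. For each θ define Z_π(θ) := ∑_{y∈Y} π(θ,y)/π_old(y), Z_A := ∑_{y∈Y} e^{A(y)/η}, P_π(θ)(y) := (π(θ,y)/π_old(y))/Z_π(θ), P_A(y) := e^{A(y)/η}/Z_A, and u(y) := P_π(θ₀)(y)/P_A(y). Then the theoretical LAD loss θ ↦ ∑_{y∈Y} P_A(y) f( P_π(θ)(y)/P_A(y) ) is differentiable at θ₀ with derivative ∑_{y∈Y} P_π(θ₀)(y) · f'(u(y)) · ( ℓ'(y) − ∑_{y'∈Y}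 P_π(θ₀)(y') ℓ'(y') ); that is, the gradient of the theoretical LAD loss is the P_π-expectation of f'(u) times the centered score function. -/
open Finset

/-- An eventually positive function whose logarithm has derivative `s` at `a` has derivative
`g a * s` at `a`. -/
theorem hasDerivAt_of_hasDerivAt_log {g : ℝ → ℝ} {s a : ℝ} (hpos : ∀ᶠ x in nhds a, 0 < g x)
    (h : HasDerivAt (fun x => Real.log (g x)) s a) : HasDerivAt g (g a * s) a := by
  have hexp := h.exp
  rw [Real.exp_log hpos.self_of_nhds] at hexp
  exact hexp.congr_of_eventuallyEq (hpos.mono fun x hx => (Real.exp_log hx).symm)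

/-- Normalizing a finite family of weights to total mass one centers its score. -/
theorem hasDerivAt_div_sum_of_score {Y : Type*} [Fintype Y] {w : ℝ → Y → ℝ} {s : Y → ℝ} {a : ℝ}
    (hsum : ∑ y, w a y ≠ 0) (hw : ∀ y, HasDerivAt (fun x => w x y) (w a y * s y) a) (y : Y) :
    HasDerivAt (fun x => w x y / ∑ z, w x z)
      (w a y / (∑ z, w a z) * (s y - ∑ z, w a z / (∑ z', w a z') * s z)) a := by
  have hZ : HasDerivAt (fun x => ∑ z, w x z) (∑ z, w a z * s z) a :=
    HasDerivAt.fun_sum fun z _ => hw z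
  have hmean : ∑ z, w a z / (∑ z', w a z') * s z = (∑ z, w a z * s z) / ∑ z, w a z := by
    rw [Finset.sum_div]
    exact Finset.sum_congr rfl fun z _ => div_mul_eq_mul_div _ _ _
  refine ((hw y).fun_div hZ hsum).congr_deriv ?_
  rw [hmean]
  field_simp

/-- **Gradient of the theoretical LAD loss.** With `P_π(θ)(y) = (π θ y/πold y)/Z_π(θ)`,
`P_A(y) = e^{A(y)/η}/Z_A`, `u(y) = P_π(θ₀)(y)/P_A(y)`, and `ℓ'` the score at `θ₀`,
the theoretical LAD loss `θ ↦ ∑ P_A(y) f(P_π(θ)(y)/P_A(y))` is differentiable at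
`θ₀` with derivative `∑ P_π(θ₀)(y) · f'(u(y)) · (ℓ'(y) − ∑ P_π(θ₀)(y') ℓ'(y'))`. -/
theorem theoretical_LAD_gradient
    {Y : Type*} [Fintype Y] [Nonempty Y]
    (πold : Y → ℝ) (hold_pos : ∀ y, 0 < πold y) (hold_sum : ∑ y, πold y = 1)
    (A : Y → ℝ) (η : ℝ) (hη : 0 < η)
    (f f' : ℝ → ℝ) (hf : ∀ x : ℝ, 0 < x → HasDerivAt f (f' x) x)
    (I : Set ℝ) (hI : IsOpen I) (θ₀ : ℝ) (hθ₀ : θ₀ ∈ I)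
    (π : ℝ → Y → ℝ) (hπ_pos : ∀ θ ∈ I, ∀ y, 0 < π θ y)
    (ℓ' : Y → ℝ)
    (hℓ' : ∀ y, HasDerivAt (fun θ => Real.log (π θ y)) (ℓ' y) θ₀)
    (Zπ : ℝ → ℝ) (hZπ : ∀ θ, Zπ θ = ∑ y, π θ y / πold y)
    (ZA : ℝ) (hZA : ZA = ∑ y, Real.exp (A y / η))
    (Pπ : ℝ → Y → ℝ) (hPπ : ∀ θ y, Pπ θ y = (π θ y / πold y) / Zπ θ)
    (PA : Y → ℝ) (hPA : ∀ y, PA y = Real.exp (A y / η) / ZA)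
    (u : Y → ℝ) (hu : ∀ y, u y = Pπ θ₀ y / PA y) :
    HasDerivAt
      (fun θ => ∑ y, PA y * f (Pπ θ y / PA y))
      (∑ y, Pπ θ₀ y * f' (u y) * (ℓ' y - ∑ y', Pπ θ₀ y' * ℓ' y'))
      θ₀ := by
  obtain rfl : Zπ = fun θ => ∑ y, π θ y / πold y := funext hZπ
  have hweight_pos : ∀ y, 0 < π θ₀ y / πold y := fun y => div_pos (hπ_pos θ₀ hθ₀ y) (hold_pos y)
  have hZ_pos : 0 < ∑ y, π θ₀ y / πold y :=
    Finset.sum_pos (fun y _ => hweight_pos y) Finset.univ_nonempty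
  have hZA_pos : 0 < ZA :=
    hZA ▸ Finset.sum_pos (fun y _ => Real.exp_pos _) Finset.univ_nonempty
  have hPA_pos : ∀ y, 0 < PA y := fun y => hPA y ▸ div_pos (Real.exp_pos _) hZA_pos
  have hPπ_pos : ∀ y, 0 < Pπ θ₀ y := fun y => hPπ θ₀ y ▸ div_pos (hweight_pos y) hZ_pos
  have hweight : ∀ y, HasDerivAt (fun θ => π θ y / πold y) (π θ₀ y / πold y * ℓ' y) θ₀ := by
    intro y
    have hpos : ∀ᶠ θ in nhds θ₀, 0 < π θ y :=
      Filter.Eventually.mono (hI.mem_nhds hθ₀) fun θ hθ => hπ_pos θ hθ y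
    rw [div_mul_eq_mul_div]
    exact (hasDerivAt_of_hasDerivAt_log hpos (hℓ' y)).div_const _
  have hPπ_deriv : ∀ y, HasDerivAt (fun θ => Pπ θ y)
      (Pπ θ₀ y * (ℓ' y - ∑ y', Pπ θ₀ y' * ℓ' y')) θ₀ := by
    intro y
    simp only [hPπ]
    exact hasDerivAt_div_sum_of_score (w := fun θ y => π θ y / πold y) hZ_pos.ne' hweight y
  refine HasDerivAt.fun_sum fun y _ => ?_
  have hu_pos : 0 < Pπ θ₀ y / PA y := div_pos (hPπ_pos y) (hPA_pos y)
  have hPA_ne : PA y ≠ 0 := (hPA_pos y).ne'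
  refine (((hf _ hu_pos).comp θ₀ ((hPπ_deriv y).div_const (PA y))).const_mul (PA y)).congr_deriv ?_
  rw [hu]
  field_simp
end
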